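/- Let (R,m) be a noetherian local ring and M a nonzero finitely generated R-module of grade g with Ext^i_R(M,R) = 0 for all i ≠ g; set N = Ext^g_R(M,R). Then for every integer i ≥ g, Ω^g_R N and Ω^i_R((Ω^i_R M)*) are stably isomorphic, i.e., isomorphic up to free direct summands. -/

import Mathlib

open CategoryTheory IsLocalRing

noncomputable def ExtMod (R : Type) [CommRing R] (M N : Type) [AddCommGroup M] [Module R M]
    [AddCommGroup N] [Module R N] (i : ℕ) : ModuleCat R :=
  ((Ext R (ModuleCat.{0} R) i).obj (Opposite.op (ModuleCat.of R M))).obj (ModuleCat.of R N)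

noncomputable def mgrade (R : Type) [CommRing R] (M : Type) [AddCommGroup M] [Module R M] : ℕ :=
  sInf {i | Nontrivial (ExtMod R M R i)}

def IsTotallySelfDual (R : Type) [CommRing R] (M : Type) [AddCommGroup M] [Module R M] : Prop :=
  Nontrivial M ∧ Nonempty (ExtMod R M R (mgrade R M) ≃ₗ[R] M) ∧
    ∀ i, i ≠ mgrade R M → Subsingleton (ExtMod R M R i)

/-- A minimal free resolution of `M` over a local ring `R`: a resolution by finite free
modules all of whose differentials (and the augmentation) have image inside `𝔪`-times
the target (resp. have kernel inside `𝔪 F₀`). -/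
structure MinFreeRes (R : Type) [CommRing R] [IsLocalRing R]
    (M : Type) [AddCommGroup M] [Module R M] where
  F : ℕ → ModuleCat.{0} R
  free : ∀ n, Module.Free R (F n)
  fin : ∀ n, Module.Finite R (F n)
  d : ∀ n, F (n + 1) →ₗ[R] F n
  aug : F 0 →ₗ[R] M
  aug_surj : Function.Surjective aug
  exact_aug : LinearMap.ker aug = LinearMap.range (d 0)
  exact : ∀ n, LinearMap.ker (d n) = LinearMap.range (d (n + 1))
  minimal : ∀ n, LinearMap.range (d n) ≤ (maximalIdeal R) • (⊤ : Submodule R (F n))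

namespace MinFreeRes

variable {R : Type} [CommRing R] [IsLocalRing R]
  {M : Type} [AddCommGroup M] [Module R M]

/-- The `n`-th syzygy of `M` with respect to a minimal free resolution:
`Ω⁰ M = M` and `Ωⁿ⁺¹ M = Im(dₙ) = Ker(dₙ₋₁)`. -/
noncomputable def Syz (C : MinFreeRes R M) : ℕ → ModuleCat.{0} R
  | 0 => ModuleCat.of R M
  | n + 1 => ModuleCat.of R (LinearMap.range (C.d n))

/-- A minimal free resolution is self-dual if it is bounded, of length `r`, and is
isomorphic (as a complex) to its `R`-dual complex with reversed indexing. -/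
def SelfDual (C : MinFreeRes R M) : Prop :=
  ∃ r : ℕ, (∀ n, r < n → Subsingleton (C.F n)) ∧ Nontrivial (C.F r) ∧
    ∃ e : ∀ ⦃m n : ℕ⦄, m + n = r → (C.F n ≃ₗ[R] Module.Dual R (C.F m)),
      ∀ (q n : ℕ) (hp : (q + 1) + n = r) (hq : q + (n + 1) = r),
        (e hp).toLinearMap ∘ₗ C.d n = (C.d q).dualMap ∘ₗ (e hq).toLinearMap

/-- A minimal free resolution is eventually periodic with period `a` if
`Ωⁿ M ≅ Ωⁿ⁺ᵃ M` for some `n`. -/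
def EventuallyPeriodic (C : MinFreeRes R M) (a : ℕ) : Prop :=
  0 < a ∧ ∃ n : ℕ, Nonempty (C.Syz n ≃ₗ[R] C.Syz (n + a))

end MinFreeRes

/-- Stable isomorphism: `X ⊕ P ≅ Y ⊕ Q` for some finite free `P`, `Q`. -/
def StablyIso (R : Type) [CommRing R] (X Y : Type) [AddCommGroup X] [Module R X]
    [AddCommGroup Y] [Module R Y] : Prop :=
  ∃ (P Q : ModuleCat.{0} R), Module.Free R P ∧ Module.Finite R P ∧
    Module.Free R Q ∧ Module.Finite R Q ∧ Nonempty ((X × P) ≃ₗ[R] (Y × Q))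

section CochainHomology

universe v u

theorem CategoryTheory.ShortComplex.exists_ker_to_homology {R : Type u} [Ring R]
    (S : ShortComplex (ModuleCat.{v} R)) :
    ∃ π : LinearMap.ker S.g.hom →ₗ[R] S.homology,
      Function.Surjective π ∧ ∀ x, π x = 0 ↔ (x : S.X₂) ∈ LinearMap.range S.f.hom := by
  let e : (LinearMap.ker S.g.hom ⧸ LinearMap.range S.moduleCatToCycles) ≃ₗ[R] S.homology :=
    S.moduleCatHomologyIso.symm.toLinearEquiv
  refine ⟨e.toLinearMap ∘ₗ (LinearMap.range S.moduleCatToCycles).mkQ,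
    e.surjective.comp (Submodule.mkQ_surjective _), fun x => ?_⟩
  rw [LinearMap.comp_apply, LinearEquiv.coe_coe, LinearEquiv.map_eq_zero_iff,
    Submodule.mkQ_apply, Submodule.Quotient.mk_eq_zero, LinearMap.mem_range, LinearMap.mem_range]
  exact exists_congr fun y => Subtype.ext_iff

theorem CochainComplex.exists_ker_to_homology {R : Type u} [Ring R]
    (K : CochainComplex (ModuleCat.{v} R) ℕ) (i n : ℕ) (hi : (ComplexShape.up ℕ).prev n = i) :
    ∃ π : LinearMap.ker (K.d n (n + 1)).hom →ₗ[R] K.homology n,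
      Function.Surjective π ∧
        ∀ x, π x = 0 ↔ (x : K.X n) ∈ LinearMap.range (K.d i n).hom := by
  obtain ⟨π, hπ, hker⟩ := (K.sc' i n (n + 1)).exists_ker_to_homology
  let e := (K.homologyIsoSc' i n (n + 1) hi (by simp)).symm.toLinearEquiv
  exact ⟨e.toLinearMap ∘ₗ π, e.surjective.comp hπ, fun x => e.map_eq_zero_iff.trans (hker x)⟩

end CochainHomology

namespace MinFreeRes

variable {R : Type} [CommRing R] [IsLocalRing R]
  {M : Type} [AddCommGroup M] [Module R M]

theorem d_comp_d (C : MinFreeRes R M) (n : ℕ) : C.d n ∘ₗ C.d (n + 1) = 0 :=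
  LinearMap.range_le_ker_iff.mp (C.exact n).ge

theorem aug_comp_d (C : MinFreeRes R M) : C.aug ∘ₗ C.d 0 = 0 :=
  LinearMap.range_le_ker_iff.mp C.exact_aug.ge

/-- The chain complex underlying a minimal free resolution. -/
noncomputable def complex (C : MinFreeRes R M) : ChainComplex (ModuleCat.{0} R) ℕ :=
  ChainComplex.of C.F (fun n => ModuleCat.ofHom (C.d n)) fun n => by
    rw [← ModuleCat.ofHom_comp, C.d_comp_d, ModuleCat.ofHom_zero]

theorem complex_d (C : MinFreeRes R M) (n : ℕ) :
    C.complex.d (n + 1) n = ModuleCat.ofHom (C.d n) :=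
  ChainComplex.of_d C.F (fun n => ModuleCat.ofHom (C.d n)) n

/-- The augmentation of a minimal free resolution, as a morphism of chain complexes. -/
noncomputable def augmentation (C : MinFreeRes R M) :
    C.complex ⟶ (ChainComplex.single₀ (ModuleCat.{0} R)).obj (ModuleCat.of R M) :=
  (C.complex.toSingle₀Equiv _).symm ⟨ModuleCat.ofHom C.aug, by
    rw [C.complex_d]
    exact (ModuleCat.ofHom_comp _ _).symm.trans (by rw [C.aug_comp_d]; rfl)⟩

theorem augmentation_f_zero (C : MinFreeRes R M) :
    C.augmentation.f 0 = ModuleCat.ofHom C.aug :=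
  ChainComplex.toSingle₀Equiv_symm_apply_f_zero _ _

theorem quasiIso_augmentation (C : MinFreeRes R M) : QuasiIso C.augmentation where
  quasiIsoAt n := by
    cases n with
    | zero =>
      rw [ChainComplex.quasiIsoAt₀_iff, ShortComplex.quasiIso_iff_of_zeros' _ rfl rfl rfl]
      constructor
      · rw [ShortComplex.moduleCat_exact_iff_range_eq_ker]
        change LinearMap.range (C.complex.d 1 0).hom =
          LinearMap.ker (C.augmentation.f 0).hom
        rw [C.complex_d, C.augmentation_f_zero]
        exact C.exact_aug.symm
      · rw [ModuleCat.epi_iff_surjective]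
        change Function.Surjective (C.augmentation.f 0).hom
        rw [C.augmentation_f_zero]
        exact C.aug_surj
    | succ n =>
      rw [quasiIsoAt_iff_exactAt' (hL := ChainComplex.exactAt_succ_single_obj ..),
        HomologicalComplex.exactAt_iff' _ (n + 2) (n + 1) n (by simp) (by simp),
        ShortComplex.moduleCat_exact_iff_range_eq_ker]
      change LinearMap.range (C.complex.d (n + 2) (n + 1)).hom =
        LinearMap.ker (C.complex.d (n + 1) n).hom
      rw [C.complex_d, C.complex_d]
      exact (C.exact n).symm

/-- A minimal free resolution, as a projective resolution. -/
noncomputable def projectiveResolution (C : MinFreeRes R M) :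
    ProjectiveResolution (ModuleCat.of R M) where
  complex := C.complex
  projective n :=
    have := C.free n
    (IsProjective.iff_projective (C.F n)).mp inferInstance
  π := C.augmentation
  quasiIso := C.quasiIso_augmentation

/-- The submodule of coboundaries in degree `n` of the dual of a minimal free resolution. -/
noncomputable def coboundaries (C : MinFreeRes R M) : ∀ n, Submodule R (Module.Dual R (C.F n))
  | 0 => ⊥
  | n + 1 => LinearMap.range (C.d n).dualMap

theorem exists_ker_dualMap_to_ext (C : MinFreeRes R M) (n : ℕ) :
    ∃ π : LinearMap.ker (C.d n).dualMap →ₗ[R] ExtMod R M R n,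
      Function.Surjective π ∧ ∀ x, π x = 0 ↔ (x : Module.Dual R (C.F n)) ∈ C.coboundaries n := by
  let K := C.projectiveResolution.complex.linearYonedaObj R (ModuleCat.of R R)
  let e (m : ℕ) : K.X m ≃ₗ[R] Module.Dual R (C.F m) :=
    ModuleCat.homLinearEquiv (S := R) (M := C.F m) (N := ModuleCat.of R R)
  have he (m : ℕ) (x : K.X m) : e (m + 1) (K.d m (m + 1) x) = (C.d m).dualMap (e m x) := by
    have : K.d m (m + 1) x = C.complex.d (m + 1) m ≫ x := rfl
    rw [this, C.complex_d]
    rfl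
  have he' (m : ℕ) (x : K.X m) :
      x ∈ LinearMap.ker (K.d m (m + 1)).hom ↔ e m x ∈ LinearMap.ker (C.d m).dualMap := by
    rw [LinearMap.mem_ker, LinearMap.mem_ker, ← he, LinearEquiv.map_eq_zero_iff]
  obtain ⟨π, hπ, hker⟩ := K.exists_ker_to_homology _ n rfl
  let f : LinearMap.ker (C.d n).dualMap ≃ₗ[R] LinearMap.ker (K.d n (n + 1)).hom :=
    ((e n).ofSubmodule' (LinearMap.ker (C.d n).dualMap)).symm.trans
      (LinearEquiv.ofEq _ _ (by ext x; exact (he' n x).symm))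
  have hf (x) : e n (f x : K.X n) = x := (e n).apply_symm_apply _
  let h : K.homology n ≃ₗ[R] ExtMod R M R n :=
    (C.projectiveResolution.isoExt (R := R) n (ModuleCat.of R R)).toLinearEquiv.symm
  refine ⟨h.toLinearMap ∘ₗ π ∘ₗ f.toLinearMap, h.surjective.comp (hπ.comp f.surjective),
    fun x => (h.map_eq_zero_iff.trans (hker (f x))).trans ?_⟩
  rw [← hf x]
  generalize (f x : K.X n) = y
  cases n with
  | zero =>
    have h0 : K.d ((ComplexShape.up ℕ).prev 0) 0 = 0 := K.shape _ _ (by simp)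
    rw [h0]
    change y ∈ LinearMap.range (0 : _ →ₗ[R] _) ↔ e 0 y ∈ (⊥ : Submodule R _)
    rw [LinearMap.range_zero, Submodule.mem_bot, Submodule.mem_bot, LinearEquiv.map_eq_zero_iff]
  | succ n =>
    rw [CochainComplex.prev_nat_succ]
    constructor
    · rintro ⟨z, rfl⟩
      exact ⟨e n z, (he n z).symm⟩
    · rintro ⟨z, hz⟩
      refine ⟨(e n).symm z, (e (n + 1)).injective ((he n _).trans ?_)⟩
      rw [LinearEquiv.apply_symm_apply, hz]

end MinFreeRes

section StableSyzygies

theorem LinearMap.nonempty_equiv_ker_prod {R A Q : Type*} [Ring R] [AddCommGroup A] [Module R A]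
    [AddCommGroup Q] [Module R Q] [Module.Projective R Q] (f : A →ₗ[R] Q)
    (hf : Function.Surjective f) : Nonempty (A ≃ₗ[R] LinearMap.ker f × Q) := by
  obtain ⟨l, hl⟩ := Module.projective_lifting_property f LinearMap.id hf
  exact ⟨((f.exact_subtype_ker_map).splitSurjectiveEquiv (Submodule.subtype_injective _)
    ⟨l, hl⟩).1⟩

namespace LinearMap

variable {R A B X : Type*} [Ring R] [AddCommGroup A] [Module R A] [AddCommGroup B] [Module R B]
  [AddCommGroup X] [Module R X]

/-- The fibre product of two linear maps with the same target. -/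
def fiberProd (p : A →ₗ[R] X) (q : B →ₗ[R] X) : Submodule R (A × B) :=
  LinearMap.eqLocus (p ∘ₗ LinearMap.fst R A B) (q ∘ₗ LinearMap.snd R A B)

variable (p : A →ₗ[R] X) (q : B →ₗ[R] X)

/-- The first projection of a fibre product. -/
def fiberFst : fiberProd p q →ₗ[R] A := LinearMap.fst R A B ∘ₗ (fiberProd p q).subtype

/-- The second projection of a fibre product. -/
def fiberSnd : fiberProd p q →ₗ[R] B := LinearMap.snd R A B ∘ₗ (fiberProd p q).subtype

theorem fiberFst_surjective (hq : Function.Surjective q) :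
    Function.Surjective (fiberFst p q) := fun a =>
  let ⟨b, hb⟩ := hq (p a)
  ⟨⟨(a, b), hb.symm⟩, rfl⟩

theorem fiberSnd_surjective (hp : Function.Surjective p) :
    Function.Surjective (fiberSnd p q) := fun b =>
  let ⟨a, ha⟩ := hp (q b)
  ⟨⟨(a, b), ha⟩, rfl⟩

/-- The kernel of the first projection of a fibre product is the kernel of the second map. -/
def kerFiberFstEquiv : LinearMap.ker (fiberFst p q) ≃ₗ[R] LinearMap.ker q where
  toFun x := ⟨x.1.1.2, x.1.2.symm.trans ((congrArg p x.2).trans p.map_zero)⟩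
  map_add' _ _ := rfl
  map_smul' _ _ := rfl
  invFun y := ⟨⟨(0, y), p.map_zero.trans (Eq.symm y.2)⟩, rfl⟩
  left_inv x := Subtype.ext (Subtype.ext (Prod.ext (Eq.symm x.2) rfl))
  right_inv _ := rfl

/-- The kernel of the second projection of a fibre product is the kernel of the first map. -/
def kerFiberSndEquiv : LinearMap.ker (fiberSnd p q) ≃ₗ[R] LinearMap.ker p where
  toFun x := ⟨x.1.1.1, Eq.trans x.1.2 ((congrArg q x.2).trans q.map_zero)⟩
  map_add' _ _ := rfl
  map_smul' _ _ := rfl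
  invFun y := ⟨⟨(y, 0), Eq.trans y.2 q.map_zero.symm⟩, rfl⟩
  left_inv x := Subtype.ext (Subtype.ext (Prod.ext rfl (Eq.symm x.2)))
  right_inv _ := rfl

/-- Schanuel's lemma. -/
theorem nonempty_ker_prod_equiv_ker_prod [Module.Projective R A] [Module.Projective R B]
    (hp : Function.Surjective p) (hq : Function.Surjective q) :
    Nonempty ((LinearMap.ker p × B) ≃ₗ[R] (LinearMap.ker q × A)) := by
  obtain ⟨e⟩ := (fiberFst p q).nonempty_equiv_ker_prod (fiberFst_surjective p q hq)
  obtain ⟨e'⟩ := (fiberSnd p q).nonempty_equiv_ker_prod (fiberSnd_surjective p q hp)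
  exact ⟨((kerFiberSndEquiv p q).symm.prodCongr (.refl R B)).trans
    (e'.symm.trans (e.trans ((kerFiberFstEquiv p q).prodCongr (.refl R A))))⟩

end LinearMap

variable {R : Type} [CommRing R]

namespace StablyIso

variable {X Y Z : Type} [AddCommGroup X] [Module R X] [AddCommGroup Y] [Module R Y]
  [AddCommGroup Z] [Module R Z]

theorem of_prod_equiv {P Q : Type} [AddCommGroup P] [Module R P] [AddCommGroup Q] [Module R Q]
    [Module.Free R P] [Module.Finite R P] [Module.Free R Q] [Module.Finite R Q]
    (e : (X × P) ≃ₗ[R] (Y × Q)) : StablyIso R X Y :=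
  ⟨ModuleCat.of R P, ModuleCat.of R Q, ‹_›, ‹_›, ‹_›, ‹_›, ⟨e⟩⟩

theorem of_equiv (e : X ≃ₗ[R] Y) : StablyIso R X Y :=
  of_prod_equiv (e.prodCongr (.refl R PUnit))

theorem symm (h : StablyIso R X Y) : StablyIso R Y X := by
  obtain ⟨P, Q, hP, hP', hQ, hQ', ⟨e⟩⟩ := h
  exact ⟨Q, P, hQ, hQ', hP, hP', ⟨e.symm⟩⟩

theorem trans (h : StablyIso R X Y) (h' : StablyIso R Y Z) : StablyIso R X Z := by
  obtain ⟨P, Q, _, _, _, _, ⟨e⟩⟩ := h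
  obtain ⟨P', Q', _, _, _, _, ⟨e'⟩⟩ := h'
  refine of_prod_equiv (P := P × P') (Q := Q' × Q) ?_
  exact (LinearEquiv.prodAssoc R X P P').symm ≪≫ₗ e.prodCongr (.refl R P') ≪≫ₗ
    LinearEquiv.prodAssoc R Y Q P' ≪≫ₗ
    (LinearEquiv.refl R Y).prodCongr (LinearEquiv.prodComm R Q P') ≪≫ₗ
    (LinearEquiv.prodAssoc R Y P' Q).symm ≪≫ₗ e'.prodCongr (.refl R Q) ≪≫ₗ
    LinearEquiv.prodAssoc R Z Q' Q

theorem of_surjective_free {Q : Type} [AddCommGroup Q] [Module R Q] [Module.Free R Q]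
    [Module.Finite R Q] (f : X →ₗ[R] Q) (hf : Function.Surjective f) :
    StablyIso R X (LinearMap.ker f) := by
  obtain ⟨e⟩ := f.nonempty_equiv_ker_prod hf
  exact of_prod_equiv (P := PUnit) (LinearEquiv.prodUnique.trans e)

theorem ker_of_surjective {F G : Type} [AddCommGroup F] [Module R F] [Module.Free R F]
    [Module.Finite R F] [AddCommGroup G] [Module R G] [Module.Free R G] [Module.Finite R G]
    (p : F →ₗ[R] X) (hp : Function.Surjective p) (q : G →ₗ[R] X) (hq : Function.Surjective q) :
    StablyIso R (LinearMap.ker p) (LinearMap.ker q) := by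
  obtain ⟨e⟩ := LinearMap.nonempty_ker_prod_equiv_ker_prod p q hp hq
  exact of_prod_equiv e

end StablyIso

/-- `IsSyzygy R S n X` says that `S` is, up to stable isomorphism, an `n`-th syzygy of `X`, with
respect to a not necessarily minimal resolution by finite free modules. -/
def IsSyzygy (R : Type) [CommRing R] (S : Type) [AddCommGroup S] [Module R S] :
    ℕ → ∀ (X : Type) [AddCommGroup X] [Module R X], Prop
  | 0, X, _, _ => StablyIso R X S
  | n + 1, X, _, _ => ∃ (F : ModuleCat.{0} R) (p : F →ₗ[R] X), Module.Free R F ∧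
      Module.Finite R F ∧ Function.Surjective p ∧ IsSyzygy R S n (LinearMap.ker p)

/-- `HasFreeResolution R n X` says that `X` has a resolution by at most `n` finite free modules,
so that only the zero module qualifies when `n = 0`. -/
def HasFreeResolution (R : Type) [CommRing R] :
    ℕ → ∀ (X : Type) [AddCommGroup X] [Module R X], Prop
  | 0, X, _, _ => Subsingleton X
  | n + 1, X, _, _ => ∃ (F : ModuleCat.{0} R) (p : F →ₗ[R] X), Module.Free R F ∧
      Module.Finite R F ∧ Function.Surjective p ∧ HasFreeResolution R n (LinearMap.ker p)

variable {S T X Y : Type} [AddCommGroup S] [Module R S] [AddCommGroup T] [Module R T]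
  [AddCommGroup X] [Module R X] [AddCommGroup Y] [Module R Y]

theorem HasFreeResolution.of_equiv {n : ℕ} (h : HasFreeResolution R n X) (e : X ≃ₗ[R] Y) :
    HasFreeResolution R n Y := by
  cases n with
  | zero => exact e.symm.toEquiv.subsingleton_congr.mpr h
  | succ n =>
    obtain ⟨F, p, hF, hF', hp, h⟩ := h
    refine ⟨F, e.toLinearMap ∘ₗ p, hF, hF', e.surjective.comp hp, ?_⟩
    rwa [LinearEquiv.ker_comp]

theorem HasFreeResolution.of_ker {F : Type} [AddCommGroup F] [Module R F] [Module.Free R F]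
    [Module.Finite R F] (p : F →ₗ[R] X) (hp : Function.Surjective p) {n : ℕ}
    (h : HasFreeResolution R n (LinearMap.ker p)) : HasFreeResolution R (n + 1) X :=
  ⟨ModuleCat.of R F, p, ‹_›, ‹_›, hp, h⟩

namespace IsSyzygy

theorem of_ker {F : Type} [AddCommGroup F] [Module R F] [Module.Free R F]
    [Module.Finite R F] (p : F →ₗ[R] X) (hp : Function.Surjective p) {n : ℕ}
    (h : IsSyzygy R S n (LinearMap.ker p)) : IsSyzygy R S (n + 1) X :=
  ⟨ModuleCat.of R F, p, ‹_›, ‹_›, hp, h⟩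

theorem of_stablyIso {n : ℕ} (h : IsSyzygy R S n X) (hXY : StablyIso R X Y) :
    IsSyzygy R S n Y := by
  induction n generalizing X Y with
  | zero => exact hXY.symm.trans h
  | succ n ih =>
    obtain ⟨F, p, _, _, hp, h⟩ := h
    obtain ⟨P, Q, _, _, _, _, ⟨e⟩⟩ := hXY
    let u : (F × P) →ₗ[R] (Y × Q) := e.toLinearMap ∘ₗ p.prodMap LinearMap.id
    have hu : Function.Surjective u :=
      e.surjective.comp (Function.Surjective.prodMap hp Function.surjective_id)
    let f : (F × P) →ₗ[R] Y := LinearMap.fst R Y Q ∘ₗ u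
    let k : LinearMap.ker f →ₗ[R] Q := LinearMap.snd R Y Q ∘ₗ u ∘ₗ (LinearMap.ker f).subtype
    have hk : Function.Surjective k := fun q =>
      let ⟨a, ha⟩ := hu (0, q)
      ⟨⟨a, congrArg Prod.fst ha⟩, congrArg Prod.snd ha⟩
    have hzero (x : F) (y : P) : u (x, y) = 0 ↔ p x = 0 ∧ y = 0 :=
      e.map_eq_zero_iff.trans Prod.mk_eq_zero
    let w : LinearMap.ker p ≃ₗ[R] LinearMap.ker k :=
      { toFun x := ⟨⟨(x, 0), congrArg Prod.fst ((hzero x 0).mpr ⟨x.2, rfl⟩)⟩,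
          congrArg Prod.snd ((hzero x 0).mpr ⟨x.2, rfl⟩)⟩
        map_add' x y := Subtype.ext (Subtype.ext (Prod.ext rfl (add_zero 0).symm))
        map_smul' r x := Subtype.ext (Subtype.ext (Prod.ext rfl (smul_zero r).symm))
        invFun x := ⟨x.1.1.1, ((hzero _ _).mp (Prod.ext x.1.2 x.2)).1⟩
        left_inv _ := rfl
        right_inv x :=
          Subtype.ext (Subtype.ext (Prod.ext rfl ((hzero _ _).mp (Prod.ext x.1.2 x.2)).2.symm)) }
    exact of_ker f (Prod.fst_surjective.comp hu)
      (ih h ((StablyIso.of_equiv w).trans (StablyIso.of_surjective_free k hk).symm))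

theorem ker {F : Type} [AddCommGroup F] [Module R F] [Module.Free R F]
    [Module.Finite R F] (p : F →ₗ[R] X) (hp : Function.Surjective p) {n : ℕ}
    (h : IsSyzygy R S (n + 1) X) : IsSyzygy R S n (LinearMap.ker p) := by
  obtain ⟨G, q, _, _, hq, h⟩ := h
  exact h.of_stablyIso (StablyIso.ker_of_surjective q hq p hp)

theorem stablyIso {n : ℕ} (h : IsSyzygy R S n X) (h' : IsSyzygy R T n X) : StablyIso R S T := by
  induction n generalizing X with
  | zero => exact StablyIso.trans (StablyIso.symm h) h'
  | succ n ih =>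
    obtain ⟨F, p, _, _, hp, h⟩ := h
    exact ih h (h'.ker p hp)

/-- Passing to a quotient by a submodule of projective dimension less than `n` does not change
`n`-th syzygies. -/
theorem of_surjective {n : ℕ} (h : IsSyzygy R S n X) (π : X →ₗ[R] Y)
    (hπ : Function.Surjective π) (hker : HasFreeResolution R n (LinearMap.ker π)) :
    IsSyzygy R S n Y := by
  induction n generalizing X Y with
  | zero =>
    have : Subsingleton (LinearMap.ker π) := hker
    have hinj : Function.Injective π :=
      LinearMap.ker_eq_bot.mp (Submodule.subsingleton_iff_eq_bot.mp this)
    exact h.of_stablyIso (StablyIso.of_equiv (LinearEquiv.ofBijective π ⟨hinj, hπ⟩))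
  | succ n ih =>
    obtain ⟨F, p, _, _, hp, h⟩ := h
    obtain ⟨G, q, _, _, hq, hker⟩ := hker
    let r : LinearMap.ker (π ∘ₗ p) →ₗ[R] LinearMap.ker π := p.restrict fun x hx => hx
    have hr : Function.Surjective r := fun y =>
      let ⟨x, hx⟩ := hp y
      ⟨⟨x, (congrArg π hx).trans y.2⟩, Subtype.ext hx⟩
    let w : LinearMap.ker p ≃ₗ[R] LinearMap.ker r :=
      { toFun x := ⟨⟨x, (congrArg π x.2).trans π.map_zero⟩, Subtype.ext x.2⟩
        map_add' _ _ := rfl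
        map_smul' _ _ := rfl
        invFun x := ⟨x.1.1, congrArg Subtype.val x.2⟩
        left_inv _ := rfl
        right_inv _ := rfl }
    have hP : IsSyzygy R S n (LinearMap.fiberProd r q) :=
      h.of_stablyIso (((StablyIso.of_equiv w).trans
        (StablyIso.of_equiv (LinearMap.kerFiberSndEquiv r q).symm)).trans
        (StablyIso.of_surjective_free _ (LinearMap.fiberSnd_surjective r q hr)).symm)
    exact of_ker (π ∘ₗ p) (hπ.comp hp) (ih hP _ (LinearMap.fiberFst_surjective r q hq)
      (hker.of_equiv (LinearMap.kerFiberFstEquiv r q).symm))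

theorem of_surjective_of_submodule {A : Type} [AddCommGroup A] [Module R A]
    {B Z : Submodule R A} (hBZ : B ≤ Z) {n : ℕ} (h : IsSyzygy R S n Z) (π : Z →ₗ[R] Y)
    (hπ : Function.Surjective π) (hker : ∀ x, π x = 0 ↔ (x : A) ∈ B)
    (hB : HasFreeResolution R n B) : IsSyzygy R S n Y := by
  refine h.of_surjective π hπ (hB.of_equiv ?_)
  have hπB : LinearMap.ker π = B.comap Z.subtype := Submodule.ext hker
  rw [hπB]
  exact (Submodule.comapSubtypeEquivOfLe hBZ).symm

end IsSyzygy

end StableSyzygies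

namespace MinFreeRes

variable {R : Type} [CommRing R] [IsLocalRing R]
  {M : Type} [AddCommGroup M] [Module R M]

theorem exists_surjective_syz (C : MinFreeRes R M) (n : ℕ) :
    ∃ p : C.F n →ₗ[R] C.Syz n, Function.Surjective p ∧
      LinearMap.ker p = LinearMap.range (C.d n) := by
  cases n with
  | zero => exact ⟨C.aug, C.aug_surj, C.exact_aug⟩
  | succ n =>
    exact ⟨(C.d n).rangeRestrict, (C.d n).surjective_rangeRestrict,
      (LinearMap.ker_rangeRestrict _).trans (C.exact n)⟩

theorem isSyzygy_syz_add (C : MinFreeRes R M) (n k m : ℕ) (hm : k + n = m) :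
    IsSyzygy R (C.Syz m) n (C.Syz k) := by
  induction n generalizing k with
  | zero =>
    obtain rfl : k = m := hm
    exact StablyIso.of_equiv (.refl R _)
  | succ n ih =>
    have := C.free k
    have := C.fin k
    obtain ⟨p, hp, hker⟩ := C.exists_surjective_syz k
    refine IsSyzygy.of_ker p hp ?_
    rw [hker]
    exact ih (k + 1) (by omega)

theorem isSyzygy_syz (C : MinFreeRes R M) (n : ℕ) : IsSyzygy R (C.Syz n) n M :=
  C.isSyzygy_syz_add n 0 n (Nat.zero_add n)

theorem nonempty_dual_syz_equiv (C : MinFreeRes R M) (n : ℕ) :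
    Nonempty (Module.Dual R (C.Syz n) ≃ₗ[R] LinearMap.ker (C.d n).dualMap) := by
  obtain ⟨p, hp, hker⟩ := C.exists_surjective_syz n
  have hex : LinearMap.ker (C.d n).dualMap = LinearMap.range p.dualMap :=
    LinearMap.exact_iff.mp
      (LinearMap.exact_lcomp_of_exact_of_surjective R (LinearMap.exact_iff.mpr hker) hp)
  exact ⟨(LinearEquiv.ofInjective p.dualMap (LinearMap.dualMap_injective_of_surjective hp)).trans
    (LinearEquiv.ofEq _ _ hex.symm)⟩

theorem coboundaries_le_ker (C : MinFreeRes R M) (n : ℕ) :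
    C.coboundaries n ≤ LinearMap.ker (C.d n).dualMap := by
  cases n with
  | zero => exact bot_le
  | succ n =>
    refine LinearMap.range_le_ker_iff.mpr ?_
    rw [LinearMap.dualMap_comp_dualMap, C.d_comp_d]
    exact LinearMap.ext fun f => LinearMap.ext fun _ => f.map_zero

/-- The differential of the dual complex, as a map onto the coboundaries. -/
noncomputable def toCoboundaries (C : MinFreeRes R M) (n : ℕ) :
    Module.Dual R (C.F n) →ₗ[R] C.coboundaries (n + 1) :=
  (C.d n).dualMap.rangeRestrict

theorem toCoboundaries_surjective (C : MinFreeRes R M) (n : ℕ) :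
    Function.Surjective (C.toCoboundaries n) :=
  LinearMap.surjective_rangeRestrict _

theorem ker_toCoboundaries (C : MinFreeRes R M) (n : ℕ) :
    LinearMap.ker (C.toCoboundaries n) = LinearMap.ker (C.d n).dualMap :=
  LinearMap.ker_rangeRestrict _

theorem coboundaries_eq_ker (C : MinFreeRes R M) (n : ℕ) [Subsingleton (ExtMod R M R n)] :
    C.coboundaries n = LinearMap.ker (C.d n).dualMap := by
  refine (C.coboundaries_le_ker n).antisymm fun x hx => ?_
  obtain ⟨π, -, hπ⟩ := C.exists_ker_dualMap_to_ext n
  exact (hπ ⟨x, hx⟩).mp (Subsingleton.elim _ _)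

theorem hasFreeResolution_coboundaries (C : MinFreeRes R M) (n : ℕ)
    (h : ∀ i < n, Subsingleton (ExtMod R M R i)) :
    HasFreeResolution R n (C.coboundaries n) := by
  induction n with
  | zero => exact inferInstanceAs (Subsingleton (⊥ : Submodule R (Module.Dual R (C.F 0))))
  | succ n ih =>
    have := C.free n
    have := C.fin n
    have := h n n.lt_succ_self
    refine HasFreeResolution.of_ker (C.toCoboundaries n) (C.toCoboundaries_surjective n) ?_
    rw [C.ker_toCoboundaries, ← C.coboundaries_eq_ker]
    exact ih fun i hi => h i (hi.trans n.lt_succ_self)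

theorem isSyzygy_ker_dualMap_of_add (C : MinFreeRes R M) {S : Type} [AddCommGroup S]
    [Module R S] (g j : ℕ) (h : ∀ i, g < i → Subsingleton (ExtMod R M R i))
    (hS : IsSyzygy R S (g + j) (LinearMap.ker (C.d (g + j)).dualMap)) :
    IsSyzygy R S g (LinearMap.ker (C.d g).dualMap) := by
  induction j with
  | zero => exact hS
  | succ j ih =>
    have := C.free (g + j)
    have := C.fin (g + j)
    have := h (g + j + 1) (by omega)
    change IsSyzygy R S (g + j + 1) (LinearMap.ker (C.d (g + j + 1)).dualMap) at hS
    rw [← C.coboundaries_eq_ker] at hS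
    have hS' := hS.ker (C.toCoboundaries (g + j)) (C.toCoboundaries_surjective (g + j))
    rw [C.ker_toCoboundaries] at hS'
    exact ih hS'

theorem isSyzygy_ext (C : MinFreeRes R M) {S : Type} [AddCommGroup S] [Module R S] (g : ℕ)
    (h : ∀ i < g, Subsingleton (ExtMod R M R i))
    (hS : IsSyzygy R S g (LinearMap.ker (C.d g).dualMap)) :
    IsSyzygy R S g (ExtMod R M R g) := by
  obtain ⟨π, hπ, hker⟩ := C.exists_ker_dualMap_to_ext g
  exact IsSyzygy.of_surjective_of_submodule (C.coboundaries_le_ker g) hS π hπ hker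
    (C.hasFreeResolution_coboundaries g h)

end MinFreeRes

/-- Let `M` be nonzero of grade `g` with `Ext^i_R(M,R) = 0` for all `i ≠ g`, and set
`N = Ext^g_R(M,R)`. Then `Ω^g N ≈ Ω^i((Ωⁱ M)*)` (stably isomorphic) for all `i ≥ g`. -/
theorem stmt_17 (R : Type) [CommRing R] [IsLocalRing R] [IsNoetherianRing R]
    (M : Type) [AddCommGroup M] [Module R M] [Module.Finite R M] [Nontrivial M]
    (g : ℕ) (hg : mgrade R M = g)
    (hvan : ∀ i : ℕ, i ≠ g → Subsingleton (ExtMod R M R i))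
    (C : MinFreeRes R M) (D : MinFreeRes R (ExtMod R M R g)) :
    ∀ i : ℕ, g ≤ i → ∀ E : MinFreeRes R (Module.Dual R (C.Syz i)),
      StablyIso R (D.Syz g) (E.Syz i) := by
  intro i hi E
  obtain ⟨j, rfl⟩ := Nat.exists_eq_add_of_le hi
  obtain ⟨e⟩ := C.nonempty_dual_syz_equiv (g + j)
  have he : StablyIso R (Module.Dual R (C.Syz (g + j))) (LinearMap.ker (C.d (g + j)).dualMap) :=
    StablyIso.of_equiv e
  have hZ := (E.isSyzygy_syz (g + j)).of_stablyIso he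
  have hZg := C.isSyzygy_ker_dualMap_of_add g j (fun i hi => hvan i hi.ne') hZ
  exact (D.isSyzygy_syz g).stablyIso (C.isSyzygy_ext g (fun i hi => hvan i hi.ne) hZg)
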